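/- Let c > 0, κ ∈ ℝ, d > 0 and α ∈ ℝ. Let φ : [0,1] → ℝ and l : [0,1] → ℝ be twice continuously differentiable, and assume that (e^{α·φ}·l')'(t) ≤ −e^{α·φ(t)}·( c·l'(t)² + c^{−1}·κ·d²·e^{−2α·φ(t)} ) for all t ∈ (0,1). Define s(t) := ∫₀^t e^{−α·φ(ξ)} dξ and a := s(1), and assume κ·d² < π²/a². Let moreover D̄ : [0,1] → [0,∞) be a concave function. Then for every t ∈ (0,1), ( e^{l(t)}·D̄(t) )^{c/(c+1)} ≥ (1−t)^{c/(c+1)}·( 𝔰_κ((a − s(t))·d)/𝔰_κ(a·d) )^{1/(c+1)}·( e^{l(0)}·D̄(0) )^{c/(c+1)} + t^{c/(c+1)}·( 𝔰_κ(s(t)·d)/𝔰_κ(a·d) )^{1/(c+1)}·( e^{l(1)}·D̄(1) )^{c/(c+1)}. -/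

import Mathlib

open Set intervalIntegral

/-- The comparison function `𝔰_κ`, the solution of `ψ'' + κψ = 0` with
`ψ(0) = 0`, `ψ'(0) = 1`. -/
noncomputable def sk (κ s : ℝ) : ℝ :=
  if 0 < κ then Real.sin (Real.sqrt κ * s) / Real.sqrt κ
  else if κ = 0 then s
  else Real.sinh (Real.sqrt |κ| * s) / Real.sqrt |κ|

/-- The derivative of the comparison function `𝔰_κ`. -/
noncomputable def ck (κ s : ℝ) : ℝ :=
  if 0 < κ then Real.cos (Real.sqrt κ * s)
  else if κ = 0 then 1
  else Real.cosh (Real.sqrt |κ| * s)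

theorem hasDerivAt_sk (κ x : ℝ) : HasDerivAt (sk κ) (ck κ x) x := by
  rcases lt_trichotomy 0 κ with h | h | h
  · have hs : 0 < Real.sqrt κ := Real.sqrt_pos.2 h
    have e : sk κ = fun s => Real.sin (Real.sqrt κ * s) / Real.sqrt κ := by
      ext s; simp [sk, h]
    rw [e]
    refine HasDerivAt.congr_deriv ((((hasDerivAt_id x).const_mul (Real.sqrt κ)).sin).div_const (Real.sqrt κ)) ?_
    simp only [ck, h, if_true, id]
    field_simp
  · subst h
    have e : sk 0 = id := by ext s; simp [sk]
    rw [e]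
    simpa [ck] using hasDerivAt_id x
  · have hs : 0 < Real.sqrt |κ| := Real.sqrt_pos.2 (abs_pos.2 h.ne)
    have e : sk κ = fun s => Real.sinh (Real.sqrt |κ| * s) / Real.sqrt |κ| := by
      ext s; simp [sk, h.not_gt, h.ne]
    rw [e]
    refine HasDerivAt.congr_deriv ((((hasDerivAt_id x).const_mul (Real.sqrt |κ|)).sinh).div_const (Real.sqrt |κ|)) ?_
    simp only [ck, h.not_gt, h.ne, if_false, id]
    field_simp

theorem hasDerivAt_ck (κ x : ℝ) : HasDerivAt (ck κ) (-κ * sk κ x) x := by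
  rcases lt_trichotomy 0 κ with h | h | h
  · have hs : 0 < Real.sqrt κ := Real.sqrt_pos.2 h
    have e : ck κ = fun s => Real.cos (Real.sqrt κ * s) := by
      ext s; simp [ck, h]
    rw [e]
    refine HasDerivAt.congr_deriv (((hasDerivAt_id x).const_mul (Real.sqrt κ)).cos) ?_
    simp only [sk, h, if_true, id]
    field_simp
    rw [Real.sq_sqrt h.le]
    ring
  · subst h
    have e : ck 0 = fun _ => 1 := by ext s; simp [ck]
    rw [e]
    simpa using hasDerivAt_const x (1 : ℝ)
  · have hs : 0 < Real.sqrt |κ| := Real.sqrt_pos.2 (abs_pos.2 h.ne)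
    have e : ck κ = fun s => Real.cosh (Real.sqrt |κ| * s) := by
      ext s; simp [ck, h.not_gt, h.ne]
    rw [e]
    refine HasDerivAt.congr_deriv (((hasDerivAt_id x).const_mul (Real.sqrt |κ|)).cosh) ?_
    simp only [sk, h.not_gt, h.ne, if_false, id]
    field_simp
    rw [Real.sq_sqrt (abs_nonneg κ), abs_of_neg h]
    ring

theorem sk_zero (κ : ℝ) : sk κ 0 = 0 := by simp [sk]

theorem sqrt_mul_lt_pi {κ b : ℝ} (h : κ * b ^ 2 < Real.pi ^ 2) :
    Real.sqrt κ * b < Real.pi := by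
  rcases le_or_gt κ 0 with hκ | hκ
  · simpa [Real.sqrt_eq_zero'.2 hκ] using Real.pi_pos
  · refine lt_of_pow_lt_pow_left₀ 2 Real.pi_pos.le ?_
    rwa [mul_pow, Real.sq_sqrt hκ.le]

theorem sk_pos {κ b x : ℝ} (h : κ * b ^ 2 < Real.pi ^ 2) (hx : 0 < x) (hxb : x ≤ b) :
    0 < sk κ x := by
  rcases lt_trichotomy 0 κ with hκ | hκ | hκ
  · have hs : 0 < Real.sqrt κ := Real.sqrt_pos.2 hκ
    have hlt : Real.sqrt κ * x < Real.pi :=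
      (mul_le_mul_of_nonneg_left hxb hs.le).trans_lt (sqrt_mul_lt_pi h)
    simp only [sk, hκ, if_true]
    exact div_pos (Real.sin_pos_of_pos_of_lt_pi (by positivity) hlt) hs
  · subst hκ
    simpa [sk] using hx
  · have hs : 0 < Real.sqrt |κ| := Real.sqrt_pos.2 (abs_pos.2 hκ.ne)
    simp only [sk, hκ.not_gt, hκ.ne, if_false]
    exact div_pos (Real.sinh_pos_iff.2 (by positivity)) hs

/-- Below the first conjugate point, `ψ'' + κψ = 0` has a solution that is positive on the
closed interval `[0, b]`, namely the translate of `ck κ` by `b / 2`. -/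
theorem ck_sub_half_pos {κ b x : ℝ} (h : κ * b ^ 2 < Real.pi ^ 2)
    (hx : x ∈ Icc 0 b) : 0 < ck κ (x - b / 2) := by
  unfold ck
  split_ifs with h1 h2
  · have hlt := sqrt_mul_lt_pi h
    have hs : 0 < Real.sqrt κ := Real.sqrt_pos.2 h1
    apply Real.cos_pos_of_mem_Ioo
    constructor <;> nlinarith [mul_nonneg hs.le hx.1, mul_nonneg hs.le (sub_nonneg.2 hx.2)]
  · exact one_pos
  · exact Real.cosh_pos _

/-- Sturm-type comparison: with respect to a time change of speed `p > 0`, a supersolution `h`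
of `h'' + k h = 0` that is nonnegative at both endpoints is nonnegative, provided there is a
solution `ψ` that is positive on the closed interval. -/
theorem nonneg_of_supersolution {k : ℝ} {p h H H' ψ Ψ : ℝ → ℝ}
    (hp : ∀ t ∈ Ioo (0 : ℝ) 1, 0 < p t)
    (hh : ContinuousOn h (Icc 0 1)) (hψ : ContinuousOn ψ (Icc 0 1))
    (hdh : ∀ t ∈ Ioo (0 : ℝ) 1, HasDerivAt h (p t * H t) t)
    (hdH : ∀ t ∈ Ioo (0 : ℝ) 1, HasDerivAt H (H' t) t)
    (hle : ∀ t ∈ Ioo (0 : ℝ) 1, H' t ≤ -k * p t * h t)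
    (hdψ : ∀ t ∈ Ioo (0 : ℝ) 1, HasDerivAt ψ (p t * Ψ t) t)
    (hdΨ : ∀ t ∈ Ioo (0 : ℝ) 1, HasDerivAt Ψ (-k * p t * ψ t) t)
    (hpos : ∀ t ∈ Icc (0 : ℝ) 1, 0 < ψ t) (h0 : 0 ≤ h 0) (h1 : 0 ≤ h 1) :
    ∀ t ∈ Ioo (0 : ℝ) 1, 0 ≤ h t := by
  have hdW : ∀ t ∈ Ioo (0 : ℝ) 1, HasDerivAt (fun u => H u * ψ u - h u * Ψ u)
      (H' t * ψ t + k * p t * h t * ψ t) t := by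
    intro t ht
    refine HasDerivAt.congr_deriv (((hdH t ht).mul (hdψ t ht)).sub ((hdh t ht).mul (hdΨ t ht))) ?_
    ring
  have hanti : AntitoneOn (fun u => H u * ψ u - h u * Ψ u) (Ioo 0 1) := by
    refine antitoneOn_of_deriv_nonpos (convex_Ioo 0 1)
      (fun t ht => (hdW t ht).continuousAt.continuousWithinAt)
      (fun t ht => ?_) (fun t ht => ?_)
    · rw [interior_Ioo] at ht
      exact (hdW t ht).differentiableAt.differentiableWithinAt
    · rw [interior_Ioo] at ht
      rw [(hdW t ht).deriv]
      nlinarith [mul_nonneg (sub_nonneg.2 (hle t ht)) (hpos t (Ioo_subset_Icc_self ht)).le]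
  have hdq : ∀ t ∈ Ioo (0 : ℝ) 1, HasDerivAt (fun u => h u / ψ u)
      (p t / ψ t ^ 2 * (H t * ψ t - h t * Ψ t)) t := by
    intro t ht
    refine HasDerivAt.congr_deriv ((hdh t ht).div (hdψ t ht) (hpos t (Ioo_subset_Icc_self ht)).ne') ?_
    ring
  have hcq : ContinuousOn (fun u => h u / ψ u) (Icc 0 1) :=
    hh.div hψ fun t ht => (hpos t ht).ne'
  intro t ht
  by_contra! hneg
  have hq : h t / ψ t < 0 := div_neg_of_neg_of_pos hneg (hpos t (Ioo_subset_Icc_self ht))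
  have hq0 : 0 ≤ h 0 / ψ 0 := div_nonneg h0 (hpos 0 (by simp)).le
  have hq1 : 0 ≤ h 1 / ψ 1 := div_nonneg h1 (hpos 1 (by simp)).le
  obtain ⟨x, hx, hx'⟩ := exists_hasDerivAt_eq_slope (fun u => h u / ψ u) _ ht.1
    (hcq.mono (Icc_subset_Icc_right ht.2.le)) fun x hx => hdq x ⟨hx.1, hx.2.trans ht.2⟩
  obtain ⟨y, hy, hy'⟩ := exists_hasDerivAt_eq_slope (fun u => h u / ψ u) _ ht.2
    (hcq.mono (Icc_subset_Icc_left ht.1.le)) fun x hx => hdq x ⟨ht.1.trans hx.1, hx.2⟩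
  have hxm : x ∈ Ioo (0 : ℝ) 1 := ⟨hx.1, hx.2.trans ht.2⟩
  have hym : y ∈ Ioo (0 : ℝ) 1 := ⟨ht.1.trans hy.1, hy.2⟩
  have hfac : ∀ z ∈ Ioo (0 : ℝ) 1, 0 < p z / ψ z ^ 2 := fun z hz =>
    div_pos (hp z hz) (pow_pos (hpos z (Ioo_subset_Icc_self hz)) 2)
  have hWx : H x * ψ x - h x * Ψ x < 0 := by
    refine neg_of_mul_neg_right ?_ (hfac x hxm).le
    rw [hx']
    exact div_neg_of_neg_of_pos (by linarith) (by linarith [ht.1])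
  have hWy : 0 < H y * ψ y - h y * Ψ y := by
    refine pos_of_mul_pos_right ?_ (hfac y hym).le
    rw [hy']
    exact div_pos (by linarith) (by linarith [ht.2])
  have := hanti hxm hym (hx.2.trans hy.1).le
  simp only at this
  linarith

/-- The two-term Hölder inequality for the conjugate weights `1 / (c + 1)` and `c / (c + 1)`. -/
theorem holder_two_terms {c A₁ A₂ B₁ B₂ : ℝ} (hc : 0 < c) (hA₁ : 0 ≤ A₁) (hA₂ : 0 ≤ A₂)
    (hB₁ : 0 ≤ B₁) (hB₂ : 0 ≤ B₂) :
    A₁ ^ (1 / (c + 1)) * B₁ ^ (c / (c + 1)) + A₂ ^ (1 / (c + 1)) * B₂ ^ (c / (c + 1))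
      ≤ (A₁ + A₂) ^ (1 / (c + 1)) * (B₁ + B₂) ^ (c / (c + 1)) := by
  have hpq : (c + 1).HolderConjugate ((c + 1) / c) := by
    rw [Real.holderConjugate_iff]
    refine ⟨by linarith, ?_⟩
    field_simp
    ring
  have key := Real.inner_le_Lp_mul_Lq_of_nonneg (Finset.univ : Finset (Fin 2))
    (f := ![A₁ ^ (1 / (c + 1)), A₂ ^ (1 / (c + 1))])
    (g := ![B₁ ^ (c / (c + 1)), B₂ ^ (c / (c + 1))]) hpq
    (by intro i _; fin_cases i <;> simp <;> positivity)
    (by intro i _; fin_cases i <;> simp <;> positivity)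
  have e₁ : 1 / (c + 1) * (c + 1) = 1 := by field_simp
  have e₂ : c / (c + 1) * ((c + 1) / c) = 1 := by field_simp
  have e₃ : 1 / ((c + 1) / c) = c / (c + 1) := by field_simp
  simp only [Fin.sum_univ_two, Matrix.cons_val_zero, Matrix.cons_val_one] at key
  rwa [← Real.rpow_mul hA₁, ← Real.rpow_mul hA₂, ← Real.rpow_mul hB₁, ← Real.rpow_mul hB₂, e₁,
    e₂, e₃, Real.rpow_one, Real.rpow_one, Real.rpow_one, Real.rpow_one] at key

/-- If `e^{c l}` dominates a combination of its endpoint values and `D` a convex combination,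
the product `e^l D` inherits a concavity inequality by Hölder. -/
theorem holder_combine {c t x y L L₀ L₁ E E₀ E₁ : ℝ} (hc : 0 < c) (ht : t ∈ Ioo (0 : ℝ) 1)
    (hx : 0 ≤ x) (hy : 0 ≤ y) (hE₀ : 0 ≤ E₀) (hE₁ : 0 ≤ E₁)
    (hL : x * Real.exp (c * L₀) + y * Real.exp (c * L₁) ≤ Real.exp (c * L))
    (hE : (1 - t) * E₀ + t * E₁ ≤ E) :
    (1 - t) ^ (c / (c + 1)) * x ^ (1 / (c + 1)) * (Real.exp L₀ * E₀) ^ (c / (c + 1))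
        + t ^ (c / (c + 1)) * y ^ (1 / (c + 1)) * (Real.exp L₁ * E₁) ^ (c / (c + 1))
      ≤ (Real.exp L * E) ^ (c / (c + 1)) := by
  have h1t : 0 ≤ 1 - t := by linarith [ht.2]
  have ht0 : 0 ≤ t := ht.1.le
  have hexp : ∀ u : ℝ, Real.exp (c * u) ^ (1 / (c + 1)) = Real.exp u ^ (c / (c + 1)) := by
    intro u
    rw [← Real.exp_mul, ← Real.exp_mul]
    congr 1
    ring
  have hEnn : 0 ≤ E := le_trans (by positivity) hE
  have hterm : ∀ {τ z u F : ℝ}, 0 ≤ τ → 0 ≤ z → 0 ≤ F →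
      τ ^ (c / (c + 1)) * z ^ (1 / (c + 1)) * (Real.exp u * F) ^ (c / (c + 1))
        = (z * Real.exp (c * u)) ^ (1 / (c + 1)) * (τ * F) ^ (c / (c + 1)) := by
    intro τ z u F hτ hz hF
    rw [Real.mul_rpow hz (Real.exp_pos _).le, hexp, Real.mul_rpow hτ hF,
      Real.mul_rpow (Real.exp_pos _).le hF]
    ring
  rw [hterm h1t hx hE₀, hterm ht0 hy hE₁, Real.mul_rpow (Real.exp_pos _).le hEnn, ← hexp]
  refine (holder_two_terms hc (by positivity) (by positivity) (by positivity)
    (by positivity)).trans ?_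
  gcongr

/-- The `𝔰_κ`-concavity of `e^{c l}` along the time change `s` of speed `p = e^{-αφ}`. -/
theorem exp_mul_ge_of_riccati {c κ d α a : ℝ} (hc : 0 < c) (hd : 0 < d) {φ l s : ℝ → ℝ}
    (hφ : ∀ t ∈ Ioo (0 : ℝ) 1, DifferentiableAt ℝ φ t)
    (hlc : ContinuousOn l (Icc 0 1))
    (hl : ∀ t ∈ Ioo (0 : ℝ) 1, DifferentiableAt ℝ l t)
    (hl' : ∀ t ∈ Ioo (0 : ℝ) 1, DifferentiableAt ℝ (deriv l) t)
    (hRic : ∀ t ∈ Ioo (0 : ℝ) 1,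
      deriv (fun u => Real.exp (α * φ u) * deriv l u) t
        ≤ -Real.exp (α * φ t) *
            (c * (deriv l t) ^ 2 + c⁻¹ * κ * d ^ 2 * Real.exp (-2 * α * φ t)))
    (hsc : ContinuousOn s (Icc 0 1))
    (hs : ∀ t ∈ Ioo (0 : ℝ) 1, HasDerivAt s (Real.exp (-α * φ t)) t)
    (hs0 : s 0 = 0) (hs1 : s 1 = a) (ha : 0 < a)
    (hsm : ∀ t ∈ Icc (0 : ℝ) 1, s t ∈ Icc 0 a)
    (hκ : κ * (a * d) ^ 2 < Real.pi ^ 2) {t : ℝ} (ht : t ∈ Ioo (0 : ℝ) 1) :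
    sk κ ((a - s t) * d) / sk κ (a * d) * Real.exp (c * l 0)
      + sk κ (s t * d) / sk κ (a * d) * Real.exp (c * l 1) ≤ Real.exp (c * l t) := by
  have had : 0 < a * d := mul_pos ha hd
  have hS : sk κ (a * d) ≠ 0 := (sk_pos hκ had le_rfl).ne'
  set S := sk κ (a * d) with hSdef
  have hskc : Continuous (sk κ) :=
    continuous_iff_continuousAt.2 fun x => (hasDerivAt_sk κ x).continuousAt
  have hckc : Continuous (ck κ) :=
    continuous_iff_continuousAt.2 fun x => (hasDerivAt_ck κ x).continuousAt
  have hinv : ∀ u, Real.exp (-α * φ u) * Real.exp (α * φ u) = 1 := by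
    intro u
    rw [← Real.exp_add]
    simp
  have hd1 : ∀ u ∈ Ioo (0 : ℝ) 1,
      HasDerivAt (fun v => (a - s v) * d) (-(Real.exp (-α * φ u) * d)) u := by
    intro u hu
    simpa using ((hs u hu).const_sub a).mul_const d
  have hd2 : ∀ u ∈ Ioo (0 : ℝ) 1,
      HasDerivAt (fun v => s v * d) (Real.exp (-α * φ u) * d) u :=
    fun u hu => (hs u hu).mul_const d
  have hd3 : ∀ u ∈ Ioo (0 : ℝ) 1,
      HasDerivAt (fun v => s v * d - a * d / 2) (Real.exp (-α * φ u) * d) u :=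
    fun u hu => (hd2 u hu).sub_const _
  have hdl : ∀ u ∈ Ioo (0 : ℝ) 1, HasDerivAt (fun v => Real.exp (c * l v))
      (Real.exp (c * l u) * (c * deriv l u)) u :=
    fun u hu => ((hl u hu).hasDerivAt.const_mul c).exp
  have hdw : ∀ u ∈ Ioo (0 : ℝ) 1, HasDerivAt (fun v => Real.exp (α * φ v) * deriv l v)
      (deriv (fun v => Real.exp (α * φ v) * deriv l v) u) u :=
    fun u hu => ((((hφ u hu).const_mul α).exp).mul (hl' u hu)).hasDerivAt
  have key := nonneg_of_supersolution (k := κ * d ^ 2) (p := fun u => Real.exp (-α * φ u))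
    (h := fun u => Real.exp (c * l u) - (sk κ ((a - s u) * d) / S * Real.exp (c * l 0)
      + sk κ (s u * d) / S * Real.exp (c * l 1)))
    (H := fun u => c * Real.exp (c * l u) * (Real.exp (α * φ u) * deriv l u)
      - (-(ck κ ((a - s u) * d) * d) / S * Real.exp (c * l 0)
      + ck κ (s u * d) * d / S * Real.exp (c * l 1)))
    (H' := fun u => c * (Real.exp (c * l u) * (c * deriv l u)) * (Real.exp (α * φ u) * deriv l u)
      + c * Real.exp (c * l u) * deriv (fun v => Real.exp (α * φ v) * deriv l v) u
      - (-(-κ * sk κ ((a - s u) * d) * (-(Real.exp (-α * φ u) * d)) * d) / S * Real.exp (c * l 0)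
      + -κ * sk κ (s u * d) * (Real.exp (-α * φ u) * d) * d / S * Real.exp (c * l 1)))
    (ψ := fun u => ck κ (s u * d - a * d / 2))
    (Ψ := fun u => -κ * d * sk κ (s u * d - a * d / 2))
    (fun u _ => Real.exp_pos _) (by fun_prop) (by fun_prop)
    ?_ ?_ ?_ ?_ ?_ ?_ ?_ ?_ t ht
  · simpa using key
  · intro u hu
    refine HasDerivAt.congr_deriv ((hdl u hu).sub
      (((((hasDerivAt_sk κ _).comp u (hd1 u hu)).div_const S).mul_const _).add
      ((((hasDerivAt_sk κ _).comp u (hd2 u hu)).div_const S).mul_const _))) ?_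
    linear_combination (-(c * Real.exp (c * l u) * deriv l u)) * hinv u
  · intro u hu
    exact (((hdl u hu).const_mul c).mul (hdw u hu)).sub
      (((((((hasDerivAt_ck κ _).comp u (hd1 u hu)).mul_const d).fun_neg).div_const S).mul_const
        _).add
      (((((hasDerivAt_ck κ _).comp u (hd2 u hu)).mul_const d).div_const S).mul_const _))
  · intro u hu
    have hmul := mul_le_mul_of_nonneg_left (hRic u hu)
      (mul_pos hc (Real.exp_pos (c * l u))).le
    have hsq : Real.exp (α * φ u) * Real.exp (-2 * α * φ u) = Real.exp (-α * φ u) := by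
      rw [← Real.exp_add]
      congr 1
      ring
    have hcc : c * c⁻¹ = 1 := mul_inv_cancel₀ hc.ne'
    have hrw : c * Real.exp (c * l u) * (-Real.exp (α * φ u) *
        (c * (deriv l u) ^ 2 + c⁻¹ * κ * d ^ 2 * Real.exp (-2 * α * φ u)))
        = -(c * (Real.exp (c * l u) * (c * deriv l u)) * (Real.exp (α * φ u) * deriv l u))
          - κ * d ^ 2 * Real.exp (-α * φ u) * Real.exp (c * l u) := by
      linear_combination (-(c * c⁻¹ * Real.exp (c * l u) * κ * d ^ 2)) * hsq
        - (Real.exp (c * l u) * κ * d ^ 2 * Real.exp (-α * φ u)) * hcc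
    rw [hrw] at hmul
    ring_nf at hmul ⊢
    linarith
  · intro u hu
    refine HasDerivAt.congr_deriv ((hasDerivAt_ck κ _).comp u (hd3 u hu)) ?_
    ring
  · intro u hu
    refine HasDerivAt.congr_deriv (((hasDerivAt_sk κ _).comp u (hd3 u hu)).const_mul (-κ * d)) ?_
    ring
  · intro u hu
    obtain ⟨h1, h2⟩ := hsm u hu
    exact ck_sub_half_pos hκ ⟨by positivity, by gcongr⟩
  · simp [hs0, sk_zero, ← hSdef, hS]
  · simp [hs1, sk_zero, ← hSdef, hS]

/-- One-dimensional analytic content of Proposition 3.1 (the key Jacobian inequality):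
the weighted Jacobian is `J(t) = e^{l(t)}·D̄(t)` with `D̄` concave and nonnegative,
`e^{l}` satisfies the `𝔰_κ`-concavity of Lemma 3.5, and the conclusion combines these
by Hölder's inequality. -/
theorem stmt_4 (c κ d α : ℝ) (hc : 0 < c) (hd : 0 < d)
    (φ l : ℝ → ℝ)
    (hφ : ContDiffOn ℝ 2 φ (Icc (0 : ℝ) 1))
    (hl : ContDiffOn ℝ 2 l (Icc (0 : ℝ) 1))
    (hRic : ∀ t ∈ Ioo (0 : ℝ) 1,
      deriv (fun u => Real.exp (α * φ u) * deriv l u) t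
        ≤ -Real.exp (α * φ t) *
            (c * (deriv l t) ^ 2 + c⁻¹ * κ * d ^ 2 * Real.exp (-2 * α * φ t)))
    (s : ℝ → ℝ) (hs : s = fun t => ∫ ξ in (0 : ℝ)..t, Real.exp (-α * φ ξ))
    (a : ℝ) (ha : a = s 1)
    (hκd : κ * d ^ 2 < Real.pi ^ 2 / a ^ 2)
    (D : ℝ → ℝ) (hD0 : ∀ t ∈ Icc (0 : ℝ) 1, 0 ≤ D t)
    (hDconc : ConcaveOn ℝ (Icc (0 : ℝ) 1) D) :
    ∀ t ∈ Ioo (0 : ℝ) 1,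
      (Real.exp (l t) * D t) ^ (c / (c + 1))
        ≥ (1 - t) ^ (c / (c + 1)) * (sk κ ((a - s t) * d) / sk κ (a * d)) ^ (1 / (c + 1)) *
            (Real.exp (l 0) * D 0) ^ (c / (c + 1))
          + t ^ (c / (c + 1)) * (sk κ (s t * d) / sk κ (a * d)) ^ (1 / (c + 1)) *
            (Real.exp (l 1) * D 1) ^ (c / (c + 1)) := by
  intro t ht
  have hIcc : ∀ u ∈ Ioo (0 : ℝ) 1, Icc (0 : ℝ) 1 ∈ nhds u := fun u hu => Icc_mem_nhds hu.1 hu.2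
  have hpc : ContinuousOn (fun ξ => Real.exp (-α * φ ξ)) (Icc 0 1) := by
    have := hφ.continuousOn
    fun_prop
  have hint : ∀ {u v : ℝ}, u ∈ Icc (0 : ℝ) 1 → v ∈ Icc (0 : ℝ) 1 →
      IntervalIntegrable (fun ξ => Real.exp (-α * φ ξ)) MeasureTheory.volume u v :=
    fun hu hv => (hpc.mono (uIcc_subset_Icc hu hv)).intervalIntegrable
  have h0 : (0 : ℝ) ∈ Icc (0 : ℝ) 1 := by simp
  have h1 : (1 : ℝ) ∈ Icc (0 : ℝ) 1 := by simp
  have hs0 : s 0 = 0 := by simp [hs]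
  have hsd : ∀ u ∈ Ioo (0 : ℝ) 1, HasDerivAt s (Real.exp (-α * φ u)) u := by
    intro u hu
    rw [hs]
    exact integral_hasDerivAt_right (hint h0 (Ioo_subset_Icc_self hu))
      ((hpc.mono Ioo_subset_Icc_self).stronglyMeasurableAtFilter isOpen_Ioo u hu)
      (hpc.continuousAt (hIcc u hu))
  have hsc : ContinuousOn s (Icc 0 1) := by
    rw [hs]
    have := continuousOn_primitive_interval' (hint h0 h1) left_mem_uIcc
    rwa [uIcc_of_le zero_le_one] at this
  have hmono : StrictMonoOn s (Icc 0 1) := by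
    refine strictMonoOn_of_deriv_pos (convex_Icc 0 1) hsc fun u hu => ?_
    rw [interior_Icc] at hu
    rw [(hsd u hu).deriv]
    exact Real.exp_pos _
  have hapos : 0 < a := by
    rw [ha, ← hs0]
    exact hmono h0 h1 zero_lt_one
  have hsm : ∀ u ∈ Icc (0 : ℝ) 1, s u ∈ Icc 0 a := by
    intro u hu
    rw [ha, ← hs0]
    exact ⟨hmono.monotoneOn h0 hu hu.1, hmono.monotoneOn hu h1 hu.2⟩
  have hκ : κ * (a * d) ^ 2 < Real.pi ^ 2 := by
    rw [lt_div_iff₀ (by positivity)] at hκd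
    linarith [show κ * (a * d) ^ 2 = κ * d ^ 2 * a ^ 2 by ring]
  have hsk : ∀ {x : ℝ}, x ∈ Icc 0 a → 0 ≤ sk κ (x * d) := by
    intro x hx
    rcases hx.1.eq_or_lt with rfl | hx0
    · simp [sk_zero]
    · exact (sk_pos hκ (mul_pos hx0 hd) (mul_le_mul_of_nonneg_right hx.2 hd.le)).le
  have hat : ∀ u ∈ Ioo (0 : ℝ) 1, ContDiffAt ℝ 2 l u := fun u hu => hl.contDiffAt (hIcc u hu)
  have hst := hsm t (Ioo_subset_Icc_self ht)
  have hconc := hDconc.2 h0 h1 (sub_nonneg.2 ht.2.le) ht.1.le (by ring)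
  simp only [smul_eq_mul, mul_zero, mul_one, zero_add] at hconc
  refine holder_combine hc ht
    (div_nonneg (hsk ⟨by linarith [hst.2], by linarith [hst.1]⟩) (hsk ⟨hapos.le, le_rfl⟩))
    (div_nonneg (hsk hst) (hsk ⟨hapos.le, le_rfl⟩)) (hD0 0 h0) (hD0 1 h1) ?_ hconc
  refine exp_mul_ge_of_riccati hc hd
    (fun u hu => (hφ.contDiffAt (hIcc u hu)).differentiableAt (by norm_num))
    hl.continuousOn (fun u hu => (hat u hu).differentiableAt (by norm_num))
    (fun u hu => ?_) hRic hsc hsd hs0 ha.symm hapos hsm hκ ht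
  have hderiv : ContDiffAt ℝ 1 (deriv l) u := (hat u hu).derivWithin (by norm_num)
  exact hderiv.differentiableAt one_ne_zero
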